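/- Let T = (Q, Σ, δ) be an S-automaton and P ⊆ Q a subset of states. The subsemigroup P⁺∘ = {𝐪∘ ∣ 𝐪 ∈ P⁺} of S(T) is infinite if and only if there exist an ω-word ξ ∈ Σ^ω and an infinite sequence p_1, p_2, … ∈ P such that for every i ∈ ℕ the map p_i⋯p_1∘ is defined on ξ and the ω-words ξ_i = p_i⋯p_1∘ξ (with ξ_0 = ξ) are pairwise distinct. -/

import Mathlib

/- Common framework for automaton semigroups acting on finite and infinite words.

An S-automaton over states `Q` and alphabet `A` is given by a partial deterministic
transition function `δ : Q → A → Option (A × Q)` (with `δ q a = some (b, p)` encoding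
the transition `q –a/b→ p`). -/

namespace AutOrbit

variable {Q A : Type*}

/-- The partial action `q∘` of a single state on a finite word. -/
def stateAct (δ : Q → A → Option (A × Q)) : Q → List A → Option (List A)
  | _, [] => some []
  | q, a :: u => (δ q a).bind fun bp => (stateAct δ bp.2 u).map fun v => bp.1 :: v

/-- The partial action `𝐪∘` of a state sequence `𝐪 = q_n … q_1` (written left-to-right,
head of the list is `q_n`; the rightmost state `q_1` is applied first). -/
def seqAct (δ : Q → A → Option (A × Q)) (l : List Q) (u : List A) : Option (List A) :=
  l.foldr (fun q acc => acc.bind (stateAct δ q)) (some u)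

/-- The length-`n` prefix of an ω-word. -/
def pre (ξ : ℕ → A) (n : ℕ) : List A := List.ofFn fun i : Fin n => ξ i

/-- The `L`-orbit `L∘u` of a finite word `u`. -/
def orbit (δ : Q → A → Option (A × Q)) (L : Set (List Q)) (u : List A) : Set (List A) :=
  {v | ∃ l ∈ L, seqAct δ l u = some v}

/-- The `L`-orbit `L∘ξ` of an ω-word `ξ`: all ω-words `η` such that some `𝐪 ∈ L` is
defined on `ξ` with `𝐪∘ξ = η` (i.e. `𝐪∘` maps every prefix of `ξ` to the
corresponding prefix of `η`). -/
def omegaOrbit (δ : Q → A → Option (A × Q)) (L : Set (List Q)) (ξ : ℕ → A) :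
    Set (ℕ → A) :=
  {η | ∃ l ∈ L, ∀ n, seqAct δ l (pre ξ n) = some (pre η n)}

/-- The set of partial maps `L∘ = {𝐪∘ ∣ 𝐪 ∈ L}`. -/
def mapsOf (δ : Q → A → Option (A × Q)) (L : Set (List Q)) :
    Set (List A → Option (List A)) :=
  {f | ∃ l ∈ L, f = seqAct δ l}

/-- `L ⊆ F*` is suffix-closed over `F`: every `𝐪 ∈ L` factorizes into factors from `F`
such that every suffix (as a word over the alphabet `F`) of the factorization is
again in `L`. -/
def SuffixClosedOver (F L : Set (List Q)) : Prop :=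
  ∀ l ∈ L, ∃ fs : List (List Q),
    (∀ f ∈ fs, f ∈ F) ∧ fs.flatten = l ∧ ∀ i, (fs.drop i).flatten ∈ L

/-- `L` is finitely suffix-closed: suffix-closed over some finite nonempty `F ⊆ Q*`. -/
def FinitelySuffixClosed (L : Set (List Q)) : Prop :=
  ∃ F : Set (List Q), F.Finite ∧ F.Nonempty ∧ SuffixClosedOver F L

/-- `u` has infinite potential w.r.t. `δ` and `L`: the orbit sizes `|L∘ux|` are unbounded. -/
def InfinitePotential (δ : Q → A → Option (A × Q)) (L : Set (List Q)) (u : List A) : Prop :=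
  ∀ C : ℕ, ∃ x : List A, C < (orbit δ L (u ++ x)).ncard

/-- The `i`-th power `𝐪^i` of a state sequence. -/
def listPow (l : List Q) (i : ℕ) : List Q := (List.replicate i l).flatten

/-- `𝐪∘` has torsion: two distinct positive powers induce the same partial map. -/
def HasTorsion (δ : Q → A → Option (A × Q)) (l : List Q) : Prop :=
  ∃ i j : ℕ, 1 ≤ i ∧ 1 ≤ j ∧ i ≠ j ∧ seqAct δ (listPow l i) = seqAct δ (listPow l j)

/-- The automaton is complete: `δ` is total. -/
def Complete (δ : Q → A → Option (A × Q)) : Prop := ∀ q a, (δ q a).isSome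

/-- The automaton is invertible: for every state, the letter-to-output-letter map is a
bijection of the alphabet (each output letter is produced by exactly one input letter). -/
def Invertible (δ : Q → A → Option (A × Q)) : Prop :=
  ∀ q b, ∃! a, ∃ p, δ q a = some (b, p)

/-- A G-automaton: a complete invertible S-automaton. -/
def GAutomaton (δ : Q → A → Option (A × Q)) : Prop := Complete δ ∧ Invertible δ

/-- Reversibility: for every input letter `a` and target state `p` there is at most one
transition `q –a/b→ p`. -/
def Reversible (δ : Q → A → Option (A × Q)) : Prop :=
  ∀ a p q₁ b₁ q₂ b₂, δ q₁ a = some (b₁, p) → δ q₂ a = some (b₂, p) → q₁ = q₂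

/-- Reversibility of the inverse automaton: for every output letter `b` and target
state `p` there is at most one transition `q –a/b→ p`. -/
def InvReversible (δ : Q → A → Option (A × Q)) : Prop :=
  ∀ b p q₁ a₁ q₂ a₂, δ q₁ a₁ = some (b, p) → δ q₂ a₂ = some (b, p) → q₁ = q₂ ∧ a₁ = a₂

/-- Bi-reversibility: the automaton and its inverse automaton are both reversible. -/
def BiReversible (δ : Q → A → Option (A × Q)) : Prop := Reversible δ ∧ InvReversible δ

/-- The dual automaton `∂T`: states are letters, letters are states; it has a transition
`a –q/p→ b` for every transition `q –a/b→ p` of `T`. -/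
def dual (δ : Q → A → Option (A × Q)) : A → Q → Option (Q × A) :=
  fun a q => (δ q a).map fun bp => (bp.2, bp.1)

/-- Adjacency of states in the underlying undirected graph of the automaton. -/
def Adj (δ : Q → A → Option (A × Q)) (q p : Q) : Prop :=
  (∃ a b, δ q a = some (b, p)) ∨ (∃ a b, δ p a = some (b, q))

/-- `P` is (the state set of) a connected component of the automaton. -/
def IsComponent (δ : Q → A → Option (A × Q)) (P : Set Q) : Prop :=
  ∃ q, P = {p | Relation.ReflTransGen (Adj δ) q p}

/-- The sub-automaton induced on `P` (with all transitions among states of `P`)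
is reversible. -/
def SubReversible (δ : Q → A → Option (A × Q)) (P : Set Q) : Prop :=
  ∀ a : A, ∀ p ∈ P, ∀ q₁ b₁ q₂ b₂, q₁ ∈ P → q₂ ∈ P →
    δ q₁ a = some (b₁, p) → δ q₂ a = some (b₂, p) → q₁ = q₂

/-- The inverse of the sub-automaton induced on `P` is reversible. -/
def SubInvReversible (δ : Q → A → Option (A × Q)) (P : Set Q) : Prop :=
  ∀ b : A, ∀ p ∈ P, ∀ q₁ a₁ q₂ a₂, q₁ ∈ P → q₂ ∈ P →
    δ q₁ a₁ = some (b, p) → δ q₂ a₂ = some (b, p) → q₁ = q₂ ∧ a₁ = a₂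

/-- The sub-automaton induced on `P` is bi-reversible. -/
def SubBiReversible (δ : Q → A → Option (A × Q)) (P : Set Q) : Prop :=
  SubReversible δ P ∧ SubInvReversible δ P

/-- For a complete automaton, the (total) action of a state on a finite word. -/
noncomputable def totAct (δ : Q → A → Option (A × Q)) (q : Q) (u : List A) : List A :=
  (stateAct δ q u).getD u

/-- The action of a state of the automaton (`Sum.inl`) or of its inverse automaton
(`Sum.inr`): for a G-automaton, `totAct δ q` is a bijection of `Σ*` and the inverse
state `q̄` acts as its inverse bijection. -/
noncomputable def gAct (δ : Q → A → Option (A × Q)) : Q ⊕ Q → List A → List A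
  | Sum.inl q => totAct δ q
  | Sum.inr q => Function.invFun (totAct δ q)

/-- Action of a sequence over `Q ⊔ Q̄` (rightmost entry applied first). -/
noncomputable def gSeqAct (δ : Q → A → Option (A × Q)) (l : List (Q ⊕ Q)) (u : List A) :
    List A :=
  l.foldr (fun s v => gAct δ s v) u

/-- The automaton group `G(T) = {𝐪∘ ∣ 𝐪 ∈ (Q ⊔ Q̄)⁺}` as a set of maps on `Σ*`. -/
def autGroup (δ : Q → A → Option (A × Q)) : Set (List A → List A) :=
  {f | ∃ l : List (Q ⊕ Q), l ≠ [] ∧ f = gSeqAct δ l}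

/-- The ultimately periodic ω-word `u (a v)^ω`. -/
def ultPer (u : List A) (a : A) (v : List A) (n : ℕ) : A :=
  if h : n < u.length then u.get ⟨n, h⟩
  else (a :: v).get ⟨(n - u.length) % (a :: v).length, Nat.mod_lt _ (by simp)⟩

/-- Run of a single state on a word, returning the output word and the final state. -/
def runState (δ : Q → A → Option (A × Q)) : Q → List A → Option (List A × Q)
  | q, [] => some ([], q)
  | q, a :: u => (δ q a).bind fun bp =>
      (runState δ bp.2 u).map fun vr => (bp.1 :: vr.1, vr.2)

/-- Run of a state sequence `𝐪` on a word `u`, returning the output word `𝐪∘u` and the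
residual state sequence `𝐪·u` (the dual action). -/
def runSeq (δ : Q → A → Option (A × Q)) : List Q → List A → Option (List A × List Q)
  | [], u => some (u, [])
  | q :: l, u => (runSeq δ l u).bind fun vr =>
      (runState δ q vr.1).map fun wp => (wp.1, wp.2 :: vr.2)

/-- Nodes of the `L`-orbital transducer over `F` of `u`: words reached from `u` along a
path of `F`-labeled edges whose reverse label (a word over `F`) lies in `L`. -/
def transNodes (δ : Q → A → Option (A × Q)) (F L : Set (List Q)) (u : List A) :
    Set (List A) :=
  {v | ∃ fs : List (List Q), (∀ f ∈ fs, f ∈ F) ∧ fs.flatten ∈ L ∧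
        ∃ r, runSeq δ fs.flatten u = some (v, r)}

/-- Edges of the `L`-orbital transducer over `F` of `u`: an edge `v –𝐩/𝐨→ w` with
`𝐩 ∈ F`, input label `𝐩`, output label `𝐨 = 𝐩·v`, lying on a path from `u` whose
reverse label is in `L`. -/
def transEdge (δ : Q → A → Option (A × Q)) (F L : Set (List Q)) (u : List A)
    (v : List A) (p o : List Q) (w : List A) : Prop :=
  p ∈ F ∧ ∃ fs : List (List Q), (∀ f ∈ fs, f ∈ F) ∧ (p :: fs).flatten ∈ L ∧
    (∃ r, runSeq δ fs.flatten u = some (v, r)) ∧ runSeq δ p v = some (w, o)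

/-- Isomorphism of the `L`-orbital transducers over `F` of `u₁` and `u₂`: a bijection of
the node sets mapping `u₁` to `u₂` and preserving labeled edges in both directions. -/
def TransducerIso (δ : Q → A → Option (A × Q)) (F L : Set (List Q)) (u₁ u₂ : List A) :
    Prop :=
  ∃ φ : List A → List A,
    Set.BijOn φ (transNodes δ F L u₁) (transNodes δ F L u₂) ∧ φ u₁ = u₂ ∧
    ∀ v ∈ transNodes δ F L u₁, ∀ w ∈ transNodes δ F L u₁, ∀ p o : List Q,
      (transEdge δ F L u₁ v p o w ↔ transEdge δ F L u₂ (φ v) p o (φ w))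

section Runs

variable (δ : Q → A → Option (A × Q))

theorem runState_append (q : Q) (u x : List A) :
    runState δ q (u ++ x) = (runState δ q u).bind fun vp =>
      (runState δ vp.2 x).map fun wr => (vp.1 ++ wr.1, wr.2) := by
  induction u generalizing q with
  | nil => simp [runState]
  | cons a u ih =>
    simp only [List.cons_append, runState, ih]
    cases δ q a with
    | none => rfl
    | some bp => cases h : runState δ bp.2 u <;> simp [h, Function.comp_def]

theorem stateAct_eq_runState (q : Q) (u : List A) :
    stateAct δ q u = (runState δ q u).map Prod.fst := by
  induction u generalizing q with
  | nil => rfl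
  | cons a u ih =>
    simp only [stateAct, runState, ih]
    cases δ q a <;> simp [Function.comp_def]

theorem length_of_runState_eq_some {q : Q} {u : List A} {vp : List A × Q}
    (h : runState δ q u = some vp) : vp.1.length = u.length := by
  induction u generalizing q vp with
  | nil => cases h; rfl
  | cons a u ih =>
    simp only [runState, Option.bind_eq_some_iff, Option.map_eq_some_iff] at h
    obtain ⟨bp, -, wr, hwr, rfl⟩ := h
    simp [ih hwr]

theorem seqAct_cons (q : Q) (l : List Q) (u : List A) :
    seqAct δ (q :: l) u = (seqAct δ l u).bind (stateAct δ q) := rfl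

theorem seqAct_append (k l : List Q) (u : List A) :
    seqAct δ (k ++ l) u = (seqAct δ l u).bind (seqAct δ k) := by
  induction k with
  | nil => exact (Option.bind_fun_some _).symm
  | cons q k ih =>
    simp only [List.cons_append, seqAct_cons, ih]
    cases seqAct δ l u <;> rfl

theorem seqAct_eq_runSeq (l : List Q) (u : List A) :
    seqAct δ l u = (runSeq δ l u).map Prod.fst := by
  induction l with
  | nil => rfl
  | cons q l ih =>
    simp only [seqAct_cons, runSeq, ih]
    cases runSeq δ l u <;> simp [stateAct_eq_runState, Function.comp_def]

theorem length_of_runSeq_eq_some {l : List Q} {u : List A} {vr : List A × List Q}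
    (h : runSeq δ l u = some vr) : vr.1.length = u.length := by
  induction l generalizing vr with
  | nil => cases h; rfl
  | cons q l ih =>
    simp only [runSeq, Option.bind_eq_some_iff, Option.map_eq_some_iff] at h
    obtain ⟨vr, hvr, wp, hwp, rfl⟩ := h
    exact (length_of_runState_eq_some δ hwp).trans (ih hvr)

theorem length_of_seqAct_eq_some {l : List Q} {u v : List A}
    (h : seqAct δ l u = some v) : v.length = u.length := by
  rw [seqAct_eq_runSeq, Option.map_eq_some_iff] at h
  obtain ⟨vr, hvr, rfl⟩ := h
  exact length_of_runSeq_eq_some δ hvr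

theorem runSeq_append (l : List Q) (u x : List A) :
    runSeq δ l (u ++ x) = (runSeq δ l u).bind fun vr =>
      (runSeq δ vr.2 x).map fun ws => (vr.1 ++ ws.1, ws.2) := by
  induction l with
  | nil => rfl
  | cons q l ih =>
    simp only [runSeq, ih]
    cases runSeq δ l u with
    | none => rfl
    | some vr =>
      simp only [Option.bind_some]
      cases hq : runState δ q vr.1 with
      | none => cases hx : runSeq δ vr.2 x <;> simp [hq, runState_append]
      | some wp =>
        simp only [Option.map_some, Option.bind_some, runSeq]
        cases hx : runSeq δ vr.2 x <;> simp [hq, runState_append, Function.comp_def]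

theorem seqAct_append_word (l : List Q) (u x : List A) :
    seqAct δ l (u ++ x) = (runSeq δ l u).bind fun vr =>
      (seqAct δ vr.2 x).map fun w => vr.1 ++ w := by
  rw [seqAct_eq_runSeq, runSeq_append]
  cases runSeq δ l u <;> simp [seqAct_eq_runSeq, Function.comp_def]

end Runs

section InfiniteWords

theorem pre_succ (ξ : ℕ → A) (n : ℕ) : pre ξ (n + 1) = pre ξ n ++ [ξ n] := by
  rw [pre, List.ofFn_succ', List.concat_eq_append]
  rfl

theorem length_pre (ξ : ℕ → A) (n : ℕ) : (pre ξ n).length = n := by simp [pre]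

theorem pre_prefix_pre (ξ : ℕ → A) {m n : ℕ} (h : m ≤ n) : pre ξ m <+: pre ξ n := by
  induction n, h using Nat.le_induction with
  | base => exact List.prefix_rfl
  | succ n _ ih => exact ih.trans (pre_succ ξ n ▸ List.prefix_append _ _)

theorem eq_of_forall_pre_eq {ξ η : ℕ → A} (h : ∀ n, pre ξ n = pre η n) : ξ = η := by
  funext n
  have := h (n + 1)
  simpa [pre_succ, h n] using this

/-- A coherent sequence of words of lengths `0, 1, 2, …` is the sequence of prefixes of an
ω-word. -/
theorem exists_forall_eq_pre (f : ℕ → List A) (hlen : ∀ n, (f n).length = n)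
    (hpre : ∀ n, f n <+: f (n + 1)) : ∃ ξ : ℕ → A, ∀ n, f n = pre ξ n := by
  refine ⟨fun n => (f (n + 1))[n]'(by simp [hlen]), fun n => ?_⟩
  induction n with
  | zero => simpa [pre] using hlen 0
  | succ n ih =>
    rw [pre_succ, ← ih]
    obtain ⟨t, ht⟩ := hpre n
    have hl := congrArg List.length ht
    rw [List.length_append, hlen, hlen, Nat.add_left_cancel_iff, List.length_eq_one_iff] at hl
    obtain ⟨a, rfl⟩ := hl
    simp [← ht, hlen]

end InfiniteWords

section Orbits

variable (δ : Q → A → Option (A × Q)) (P : Set Q)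

/-- The partial action of a sequence of states from `P`. -/
def subAct (l : List P) (u : List A) : Option (List A) := seqAct δ (l.map Subtype.val) u

/-- The residual `𝐪·u` of a sequence `𝐪` of states from `P`. -/
def subRes (l : List P) (u : List A) : Option (List Q) :=
  (runSeq δ (l.map Subtype.val) u).map Prod.snd

/-- The residual of the state `p` on the word `𝐪∘u`. -/
def headRes (p : P) (l : List P) (u : List A) : Option Q :=
  (subAct δ P l u).bind fun v => (runState δ p v).map Prod.snd

/-- Every word in the `P*`-orbit of `u` is reached in fewer than `m` steps. -/
def OrbitRadiusLT (u : List A) (m : ℕ) : Prop :=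
  ∀ l : List P, subAct δ P l u ≠ none →
    ∃ k : List P, k.length < m ∧ subAct δ P k u = subAct δ P l u

/-- The orbits of all extensions of `u` have uniformly bounded radius. -/
def BoundedPotential (u : List A) : Prop :=
  ∃ m, ∀ x, OrbitRadiusLT δ P (u ++ x) m

/-- The `P*`-orbital transducers of `u` and `w` are isomorphic: sequences have the same
residuals on both words, and identify nodes in the same way. -/
def OrbitEquiv (u w : List A) : Prop :=
  (∀ l, subRes δ P l u = subRes δ P l w) ∧
    ∀ k l, subAct δ P k u = subAct δ P l u ↔ subAct δ P k w = subAct δ P l w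

/-- The sequence `l` is defined on `u` and traces a path without repeated nodes. -/
def SimplePath (l : List P) (u : List A) : Prop :=
  subAct δ P l u ≠ none ∧
    ∀ s t, s <:+ l → t <:+ l → subAct δ P s u = subAct δ P t u → s = t

variable {δ P}

theorem subAct_nil (u : List A) : subAct δ P [] u = some u := rfl

theorem subAct_cons (p : P) (l : List P) (u : List A) :
    subAct δ P (p :: l) u = (subAct δ P l u).bind (stateAct δ p) := rfl

theorem subAct_append (k l : List P) (u : List A) :
    subAct δ P (k ++ l) u = (subAct δ P l u).bind (subAct δ P k) := by
  simp only [subAct, List.map_append, seqAct_append]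
  rfl

theorem subAct_eq_none_iff_subRes (l : List P) (u : List A) :
    subAct δ P l u = none ↔ subRes δ P l u = none := by
  simp [subAct, subRes, seqAct_eq_runSeq]

theorem subAct_cons_eq_none_iff_headRes (p : P) (l : List P) (u : List A) :
    subAct δ P (p :: l) u = none ↔ headRes δ P p l u = none := by
  rw [subAct_cons, headRes]
  cases subAct δ P l u <;> simp [stateAct_eq_runState]

theorem subRes_cons (p : P) (l : List P) (u : List A) :
    subRes δ P (p :: l) u =
      (subRes δ P l u).bind fun r => (headRes δ P p l u).map fun q => q :: r := by
  simp only [subRes, headRes, subAct, seqAct_eq_runSeq, List.map_cons, runSeq]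
  cases runSeq δ (l.map Subtype.val) u <;> simp [Function.comp_def]

theorem subRes_append_word (l : List P) (u x : List A) :
    subRes δ P l (u ++ x) =
      (subRes δ P l u).bind fun r => (runSeq δ r x).map Prod.snd := by
  simp only [subRes, runSeq_append]
  cases runSeq δ (l.map Subtype.val) u <;> simp [Function.comp_def]

theorem subAct_append_word (l : List P) (u x : List A) :
    subAct δ P l (u ++ x) = (subAct δ P l u).bind fun v =>
      ((subRes δ P l u).bind fun r => seqAct δ r x).map fun w => v ++ w := by
  simp only [subAct, subRes, seqAct_append_word]
  rw [seqAct_eq_runSeq]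
  cases runSeq δ (l.map Subtype.val) u <;> simp

theorem subAct_ne_none_of_prefix {l : List P} {u w : List A} (huw : u <+: w)
    (h : subAct δ P l w ≠ none) : subAct δ P l u ≠ none := by
  obtain ⟨x, rfl⟩ := huw
  rw [subAct_append_word] at h
  exact fun h' => h (by simp [h'])

theorem subAct_ne_none_of_suffix {s l : List P} {u : List A} (hsl : s <:+ l)
    (h : subAct δ P l u ≠ none) : subAct δ P s u ≠ none := by
  obtain ⟨t, rfl⟩ := hsl
  rw [subAct_append] at h
  exact fun h' => h (by simp [h'])

theorem subAct_append_word_eq_iff (k l : List P) (u x : List A) :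
    subAct δ P k (u ++ x) = subAct δ P l (u ++ x) ↔
      (((subRes δ P k u).bind fun r => seqAct δ r x) = none ∧
        ((subRes δ P l u).bind fun r => seqAct δ r x) = none) ∨
      (subAct δ P k u = subAct δ P l u ∧
        ((subRes δ P k u).bind fun r => seqAct δ r x) =
          (subRes δ P l u).bind fun r => seqAct δ r x) := by
  rw [subAct_append_word, subAct_append_word]
  have hk := subAct_eq_none_iff_subRes (δ := δ) k u
  have hl := subAct_eq_none_iff_subRes (δ := δ) l u
  have hlen : ∀ j : List P, ∀ v, subAct δ P j u = some v → v.length = u.length :=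
    fun j v => length_of_seqAct_eq_some δ
  rcases hku : subAct δ P k u with _ | v <;> rcases hlu : subAct δ P l u with _ | w
  · simp_all
  · simp [hk.1 hku, eq_comm (a := none)]
  · simp [hl.1 hlu]
  · have hvw : v.length = w.length := (hlen _ _ hku).trans (hlen _ _ hlu).symm
    generalize ((subRes δ P k u).bind fun r => seqAct δ r x) = a
    generalize ((subRes δ P l u).bind fun r => seqAct δ r x) = b
    cases a <;> cases b <;> simp
    exact ⟨fun h => List.append_inj h hvw, fun h => h.1 ▸ h.2 ▸ rfl⟩

theorem OrbitRadiusLT.mono {u : List A} {m n : ℕ} (h : OrbitRadiusLT δ P u m) (hmn : m ≤ n) :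
    OrbitRadiusLT δ P u n := fun l hl =>
  let ⟨k, hk, hkl⟩ := h l hl
  ⟨k, hk.trans_le hmn, hkl⟩

theorem OrbitEquiv.symm {u w : List A} (h : OrbitEquiv δ P u w) : OrbitEquiv δ P w u :=
  ⟨fun l => (h.1 l).symm, fun k l => (h.2 k l).symm⟩

theorem OrbitEquiv.append {u w : List A} (h : OrbitEquiv δ P u w) (x : List A) :
    OrbitEquiv δ P (u ++ x) (w ++ x) := by
  refine ⟨fun l => ?_, fun k l => ?_⟩
  · rw [subRes_append_word, subRes_append_word, h.1]
  · rw [subAct_append_word_eq_iff, subAct_append_word_eq_iff, h.1, h.1, h.2]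

theorem OrbitEquiv.orbitRadiusLT {u w : List A} (h : OrbitEquiv δ P u w) {m : ℕ}
    (hu : OrbitRadiusLT δ P u m) : OrbitRadiusLT δ P w m := fun l hl => by
  rw [Ne, subAct_eq_none_iff_subRes, ← h.1, ← subAct_eq_none_iff_subRes] at hl
  obtain ⟨k, hk, hkl⟩ := hu l hl
  exact ⟨k, hk, (h.2 k l).1 hkl⟩

/-- If the orbit of `u` has radius less than `m`, then the orbital transducer of `u` is
determined by its restriction to the sequences of length at most `m`. -/
theorem OrbitRadiusLT.orbitEquiv {u w : List A} {m : ℕ} (hu : OrbitRadiusLT δ P u m)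
    (hres : ∀ p : P, ∀ l : List P, l.length ≤ m → headRes δ P p l u = headRes δ P p l w)
    (hact : ∀ k l : List P, k.length ≤ m → l.length ≤ m →
      (subAct δ P k u = subAct δ P l u ↔ subAct δ P k w = subAct δ P l w)) :
    OrbitEquiv δ P u w := by
  have key : ∀ l : List P, subRes δ P l u = subRes δ P l w ∧ (subAct δ P l u ≠ none →
      ∃ k : List P, k.length < m ∧ subAct δ P k u = subAct δ P l u ∧
        subAct δ P k w = subAct δ P l w) := by
    intro l
    induction l with
    | nil =>
      refine ⟨rfl, fun h => ?_⟩
      obtain ⟨k, hk, hkl⟩ := hu [] h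
      exact ⟨k, hk, hkl, (hact k [] hk.le (Nat.zero_le _)).1 hkl⟩
    | cons p l ih =>
      obtain ⟨hl, ih⟩ := ih
      by_cases hlu : subAct δ P l u = none
      · refine ⟨?_, fun h => absurd (by simp [subAct_cons, hlu]) h⟩
        rw [subAct_eq_none_iff_subRes] at hlu
        rw [subRes_cons, subRes_cons, ← hl, hlu]
        rfl
      · obtain ⟨k, hk, hku, hkw⟩ := ih hlu
        have hhead : headRes δ P p l u = headRes δ P p l w := by
          have := hres p k hk.le
          rwa [headRes, headRes, hku, hkw] at this
        refine ⟨by rw [subRes_cons, subRes_cons, hl, hhead], fun h => ?_⟩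
        have hpu : subAct δ P (p :: k) u = subAct δ P (p :: l) u := by
          rw [subAct_cons, subAct_cons, hku]
        have hpw : subAct δ P (p :: k) w = subAct δ P (p :: l) w := by
          rw [subAct_cons, subAct_cons, hkw]
        obtain ⟨j, hj, hju⟩ := hu _ h
        exact ⟨j, hj, hju, hpw ▸ (hact j (p :: k) hj.le hk).1 (hju.trans hpu.symm)⟩
  have hnone : ∀ l : List P, subAct δ P l u = none ↔ subAct δ P l w = none := fun l => by
    rw [subAct_eq_none_iff_subRes, subAct_eq_none_iff_subRes, (key l).1]
  refine ⟨fun l => (key l).1, fun k l => ?_⟩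
  by_cases hk : subAct δ P k u = none
  · rw [hk, (hnone k).1 hk, eq_comm, hnone l, eq_comm]
  by_cases hl : subAct δ P l u = none
  · rw [hl, (hnone l).1 hl, hnone k]
  obtain ⟨k', hk', hku, hkw⟩ := (key k).2 hk
  obtain ⟨l', hl', hlu, hlw⟩ := (key l).2 hl
  rw [← hku, ← hkw, ← hlu, ← hlw]
  exact hact k' l' hk'.le hl'.le

/-- Up to isomorphism there are only finitely many orbital transducers of bounded radius. -/
theorem exists_finite_orbitEquiv_representatives [Finite Q] (m : ℕ) :
    ∃ R : Set (List A), R.Finite ∧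
      ∀ u, OrbitRadiusLT δ P u m → ∃ w ∈ R, OrbitEquiv δ P u w := by
  let N := {l : List P // l.length ≤ m}
  have : Finite N := (List.finite_length_le P m).to_subtype
  let sig : List A → (P → N → Option Q) × (N → N → Prop) := fun u =>
    (fun p l => headRes δ P p l u, fun k l => subAct δ P k u = subAct δ P l u)
  choose! rep hrep using fun s : Set.range sig => s.2
  refine ⟨Set.range rep, Set.finite_range _, fun u hu => ⟨_, ⟨⟨sig u, u, rfl⟩, rfl⟩, ?_⟩⟩
  have h := hrep ⟨sig u, u, rfl⟩
  refine hu.orbitEquiv (fun p l hl => ?_) fun k l hk hl => ?_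
  · exact (congrFun (congrFun (congrArg Prod.fst h) p) ⟨l, hl⟩).symm
  · exact (congrFun (congrFun (congrArg Prod.snd h) ⟨k, hk⟩) ⟨l, hl⟩).symm.to_iff

theorem exists_orbitRadiusLT [Finite A] (u : List A) : ∃ m, OrbitRadiusLT δ P u m := by
  have hfin : (Set.range fun l : List P => subAct δ P l u).Finite := by
    refine (((List.finite_length_eq A u.length).image some).insert none).subset ?_
    rintro _ ⟨l, rfl⟩
    rcases h : subAct δ P l u with _ | v
    · exact Or.inl h
    · exact Or.inr ⟨v, length_of_seqAct_eq_some δ h, h.symm⟩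
  have := hfin.to_subtype
  choose rep hrep using fun v : Set.range fun l : List P => subAct δ P l u => v.2
  obtain ⟨m, hm⟩ := Finite.exists_le fun v => (rep v).length
  exact ⟨m + 1, fun l _ => ⟨rep ⟨_, l, rfl⟩, Nat.lt_succ_of_le (hm _), hrep ⟨_, l, rfl⟩⟩⟩

/-- Outside of bounded potential, arbitrarily large orbits are found without losing
unbounded potential. -/
theorem exists_append_not_orbitRadiusLT [Finite Q] [Finite A] {u : List A}
    (hu : ¬ BoundedPotential δ P u) (m : ℕ) :
    ∃ x, ¬ OrbitRadiusLT δ P (u ++ x) m ∧ ¬ BoundedPotential δ P (u ++ x) := by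
  by_contra! hcon
  obtain ⟨R, hR, hrep⟩ := exists_finite_orbitEquiv_representatives (δ := δ) (P := P) m
  have := hR.to_subtype
  have hbound : ∀ wa : R × A, ∃ M, BoundedPotential δ P (wa.1.1 ++ [wa.2]) →
      ∀ z, OrbitRadiusLT δ P (wa.1.1 ++ [wa.2] ++ z) M := fun wa => by
    by_cases h : BoundedPotential δ P (wa.1.1 ++ [wa.2])
    · exact h.imp fun M hM _ => hM
    · exact ⟨0, fun h' => absurd h' h⟩
  choose M hM using hbound
  obtain ⟨C, hC⟩ := Finite.exists_le M
  have hext : ∀ x, BoundedPotential δ P (u ++ x) →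
      ∀ z, OrbitRadiusLT δ P (u ++ x ++ z) C := by
    intro x
    induction x using List.reverseRecOn with
    | nil => exact fun h => absurd (by simpa using h) hu
    | append_singleton y a ih =>
      intro hya z
      by_cases hy : BoundedPotential δ P (u ++ y)
      · simpa using ih hy (a :: z)
      · have hsmall : OrbitRadiusLT δ P (u ++ y) m := by
          by_contra h
          exact hy (hcon y h)
        obtain ⟨w, hw, heq⟩ := hrep _ hsmall
        have hwa : BoundedPotential δ P (w ++ [a]) :=
          hya.imp fun n hn v =>
            ((heq.append [a]).append v).orbitRadiusLT (by simpa using hn v)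
        have := ((heq.append [a]).append z).symm.orbitRadiusLT (hM (⟨w, hw⟩, a) hwa z)
        simpa using this.mono (hC (⟨w, hw⟩, a))
  refine hu ⟨max m C, fun x => ?_⟩
  by_cases hx : BoundedPotential δ P (u ++ x)
  · simpa using (hext x hx []).mono (le_max_right m C)
  · by_contra h
    exact hx (hcon x fun h' => h (h'.mono (le_max_left m C)))

theorem finite_range_subAct [Finite Q] [Finite A] (h : BoundedPotential δ P []) :
    (Set.range (subAct δ P)).Finite := by
  obtain ⟨m, hm⟩ := h
  obtain ⟨R, hR, hrep⟩ := exists_finite_orbitEquiv_representatives (δ := δ) (P := P) m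
  have := hR.to_subtype
  let g : List P → R → A → Option A := fun l w a =>
    ((subRes δ P l w).bind fun r => seqAct δ r [a]).bind List.head?
  have hfac : ∀ k l, g k = g l → subAct δ P k = subAct δ P l := by
    intro k l hkl
    funext u
    induction u using List.reverseRecOn with
    | nil =>
      have hnil : ∀ j : List P, subAct δ P j [] = some [] := fun j => by
        induction j with
        | nil => rfl
        | cons p j ih => rw [subAct_cons, ih]; rfl
      rw [hnil, hnil]
    | append_singleton u a ih =>
      obtain ⟨w, hw, heq⟩ := hrep u (hm u)
      rw [subAct_append_word_eq_iff]
      refine Or.inr ⟨ih, ?_⟩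
      have hga := congrFun (congrFun hkl ⟨w, hw⟩) a
      simp only [g, ← heq.1] at hga
      have hlen : ∀ j : List P, ∀ v,
          ((subRes δ P j u).bind fun r => seqAct δ r [a]) = some v → v.length = 1 := by
        intro j v hv
        obtain ⟨r, -, hr⟩ := Option.bind_eq_some_iff.1 hv
        exact length_of_seqAct_eq_some δ hr
      have hk := hlen k
      have hl := hlen l
      revert hga hk hl
      generalize ((subRes δ P k u).bind fun r => seqAct δ r [a]) = v
      generalize ((subRes δ P l u).bind fun r => seqAct δ r [a]) = w
      intro hga hk hl
      rcases v with _ | v <;> rcases w with _ | w <;>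
        simp_all [List.length_eq_one_iff] <;> grind
  choose rep hgrep using fun s : Set.range g => s.2
  refine (Set.finite_range fun s => subAct δ P (rep s)).subset ?_
  rintro _ ⟨l, rfl⟩
  exact ⟨⟨g l, l, rfl⟩, hfac _ _ (hgrep ⟨g l, l, rfl⟩)⟩

theorem exists_simplePath {u : List A} {m : ℕ} (h : ¬ OrbitRadiusLT δ P u m) :
    ∃ l : List P, m ≤ l.length ∧ SimplePath δ P l u := by
  simp only [OrbitRadiusLT, not_forall, not_exists, not_and] at h
  obtain ⟨l₀, hl₀, hlong⟩ := h
  obtain ⟨l, hl, hmin⟩ := WellFounded.has_min (measure (List.length (α := P))).wf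
    {l | subAct δ P l u = subAct δ P l₀ u} ⟨l₀, rfl⟩
  have hle : ∀ s t, s <:+ l → t <:+ l → subAct δ P s u = subAct δ P t u →
      t.length ≤ s.length := by
    rintro s t - ⟨a, rfl⟩ hst
    have := hmin (a ++ s) (by
      rw [Set.mem_ofPred_eq, subAct_append, hst, ← subAct_append]; exact hl)
    simpa [measure, WellFoundedRelation.rel, InvImage] using this
  refine ⟨l, ?_, by rwa [hl], fun s t hs ht hst => ?_⟩
  · by_contra! hlt
    exact hlong l hlt hl
  · exact (List.suffix_of_suffix_length_le hs ht (hle t s ht hs hst.symm)).eq_of_length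
      ((hle t s ht hs hst.symm).antisymm (hle s t hs ht hst))

theorem SimplePath.of_suffix {s l : List P} {u : List A} (h : SimplePath δ P l u)
    (hs : s <:+ l) : SimplePath δ P s u :=
  ⟨subAct_ne_none_of_suffix hs h.1, fun _ _ ha hb => h.2 _ _ (ha.trans hs) (hb.trans hs)⟩

/-- Unbounded potential yields an ω-word with prefixes of arbitrarily large orbits. -/
theorem exists_forall_not_orbitRadiusLT_pre [Finite Q] [Finite A]
    (h : ¬ BoundedPotential δ P []) :
    ∃ ξ : ℕ → A, ∀ m, ∃ k, m ≤ k ∧ ¬ OrbitRadiusLT δ P (pre ξ k) m := by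
  have hstep : ∀ (n : ℕ) (u : {u : List A // ¬ BoundedPotential δ P u}),
      ∃ w : {u : List A // ¬ BoundedPotential δ P u},
        u.1 <+: w.1 ∧ u.1.length < w.1.length ∧ ¬ OrbitRadiusLT δ P w.1 n := by
    rintro n ⟨u, hu⟩
    obtain ⟨m, hm⟩ := exists_orbitRadiusLT (δ := δ) (P := P) u
    obtain ⟨x, hx, hux⟩ := exists_append_not_orbitRadiusLT hu (max n m)
    refine ⟨⟨u ++ x, hux⟩, List.prefix_append _ _, ?_,
      fun h => hx (h.mono (le_max_left _ _))⟩
    rcases x with _ | ⟨a, x⟩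
    · exact absurd (by simpa using hm.mono (le_max_right n m)) hx
    · simp
  choose next hpre hlen hrad using hstep
  let u : ℕ → {u : List A // ¬ BoundedPotential δ P u} := fun n => n.rec ⟨[], h⟩ next
  have hu : ∀ n, u (n + 1) = next n (u n) := fun n => rfl
  have hmono : ∀ n, (u n).1 <+: (u (n + 1)).1 := fun n => hu n ▸ hpre n (u n)
  have hmono' : ∀ m n, m ≤ n → (u m).1 <+: (u n).1 := fun m n hmn => by
    induction n, hmn using Nat.le_induction with
    | base => exact List.prefix_rfl
    | succ n _ ih => exact ih.trans (hmono n)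
  have hle : ∀ n, n ≤ (u n).1.length := fun n => by
    induction n with
    | zero => exact Nat.zero_le _
    | succ n ih => exact hu n ▸ ih.trans_lt (hlen n (u n))
  obtain ⟨ξ, hξ⟩ := exists_forall_eq_pre (fun n => (u n).1.take n)
    (fun n => by simpa using hle n) fun n => by
      refine List.prefix_of_prefix_length_le
        ((List.take_prefix _ _).trans (hmono n)) (List.take_prefix _ _) ?_
      rw [List.length_take, List.length_take]
      have := hle n
      have := hle (n + 1)
      omega
  refine ⟨ξ, fun m => ⟨(u (m + 1)).1.length, (Nat.le_succ m).trans (hle _), ?_⟩⟩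
  have htake : (u (u (m + 1)).1.length).1.take (u (m + 1)).1.length = (u (m + 1)).1 :=
    (List.prefix_iff_eq_take.1 (hmono' _ _ (hle (m + 1)))).symm
  rw [← hξ, htake]
  exact hu m ▸ hrad m (u m)

/-- A sequence of states that extends to arbitrarily long simple paths on arbitrarily long
prefixes of `ξ`. -/
def Extendable (δ : Q → A → Option (A × Q)) (P : Set Q) (ξ : ℕ → A) (l : List P) : Prop :=
  ∀ m, ∃ k, m ≤ k ∧ ∃ t : List P, m ≤ t.length ∧ SimplePath δ P (t ++ l) (pre ξ k)

theorem Extendable.exists_cons [Finite Q] {ξ : ℕ → A} {l : List P}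
    (h : Extendable δ P ξ l) : ∃ p, Extendable δ P ξ (p :: l) := by
  by_contra! hcon
  simp only [Extendable, not_forall] at hcon
  choose m hm using hcon
  obtain ⟨M, hM⟩ := Finite.exists_le m
  obtain ⟨k, hk, t, ht, hs⟩ := h (M + 1)
  rcases t.eq_nil_or_concat with rfl | ⟨t, p, rfl⟩
  · simp at ht
  · rw [List.length_concat, Nat.add_le_add_iff_right] at ht
    exact hm p ⟨k, (hM p).trans ((Nat.le_succ M).trans hk), t, (hM p).trans ht,
      by simpa using hs⟩

theorem Extendable.exists_simplePath_pre {ξ : ℕ → A} {l : List P}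
    (h : Extendable δ P ξ l) (n : ℕ) : ∃ k, n ≤ k ∧ SimplePath δ P l (pre ξ k) :=
  let ⟨k, hk, _, _, hs⟩ := h n
  ⟨k, hk, hs.of_suffix (List.suffix_append _ _)⟩

theorem Extendable.exists_image {ξ : ℕ → A} {l : List P} (h : Extendable δ P ξ l) :
    ∃ η : ℕ → A, ∀ n, subAct δ P l (pre ξ n) = some (pre η n) := by
  have hdef : ∀ n, ∃ v, subAct δ P l (pre ξ n) = some v := fun n => by
    obtain ⟨k, hk, hs⟩ := h.exists_simplePath_pre n
    exact Option.ne_none_iff_exists'.1 (subAct_ne_none_of_prefix (pre_prefix_pre ξ hk) hs.1)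
  choose f hf using hdef
  obtain ⟨η, hη⟩ := exists_forall_eq_pre f
    (fun n => (length_of_seqAct_eq_some δ (hf n)).trans (length_pre ξ n)) fun n => by
      have h := hf (n + 1)
      rw [pre_succ, subAct_append_word, hf n, Option.bind_some, Option.map_eq_some_iff] at h
      obtain ⟨w, -, hw⟩ := h
      exact ⟨w, hw⟩
  exact ⟨η, fun n => by rw [hf, hη]⟩

/-- König's lemma: an ω-word with prefixes of arbitrarily large orbits has an infinite
simple path in its orbit. -/
theorem exists_infinite_orbital_path [Finite Q] {ξ : ℕ → A}
    (h : ∀ m, ∃ k, m ≤ k ∧ ¬ OrbitRadiusLT δ P (pre ξ k) m) :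
    ∃ (p : ℕ → P) (η : ℕ → ℕ → A),
      (∀ i n, subAct δ P (List.ofFn fun k : Fin i => p k).reverse (pre ξ n) =
        some (pre (η i) n)) ∧ Function.Injective η := by
  have hnil : Extendable δ P ξ [] := fun m => by
    obtain ⟨k, hk, hrad⟩ := h m
    obtain ⟨l, hl, hs⟩ := exists_simplePath hrad
    exact ⟨k, hk, l, hl, by simpa using hs⟩
  choose next hnext using fun l : {l : List P // Extendable δ P ξ l} => l.2.exists_cons
  let L : ℕ → {l : List P // Extendable δ P ξ l} := fun n =>
    n.rec ⟨[], hnil⟩ fun _ l => ⟨next l :: l.1, hnext l⟩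
  have hL : ∀ n, (List.ofFn fun k : Fin n => next (L k)).reverse = (L n).1 := fun n => by
    induction n with
    | zero => rfl
    | succ n ih =>
      rw [List.ofFn_succ', List.concat_eq_append, List.reverse_append]
      simpa [L] using congrArg (next (L n) :: ·) ih
  choose η hη using fun n => (L n).2.exists_image
  refine ⟨fun n => next (L n), η, fun i n => by rw [hL]; exact hη i n, ?_⟩
  have hlen : ∀ n, (L n).1.length = n := fun n => by rw [← hL]; simp
  have hsuf : ∀ m n, m ≤ n → (L m).1 <:+ (L n).1 := fun m n hmn => by
    induction n, hmn using Nat.le_induction with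
    | base => exact List.suffix_rfl
    | succ n _ ih => exact ih.trans (List.suffix_cons _ _)
  intro i j hij
  obtain ⟨k, -, hs⟩ := (L (max i j)).2.exists_simplePath_pre 0
  have := hs.2 _ _ (hsuf i _ (le_max_left i j)) (hsuf j _ (le_max_right i j))
    (by rw [hη, hη, hij])
  rw [← hlen i, this, hlen]

end Orbits

/-- For `P ⊆ Q`, the subsemigroup `P⁺∘` of `S(T)` is infinite iff there
are an ω-word `ξ` and an infinite sequence `p₁, p₂, … ∈ P` such that all the maps
`p_i ⋯ p_1∘` are defined on `ξ` and the ω-words `ξ_i = p_i ⋯ p_1∘ξ` (with `ξ_0 = ξ`) are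
pairwise distinct. -/
theorem subsemigroup_states_infinite_iff_infinite_orbital_path {Q A : Type*} [Fintype Q]
    [Fintype A] [Nonempty A] (δ : Q → A → Option (A × Q)) (P : Set Q) :
    (mapsOf δ {l : List Q | l ≠ [] ∧ ∀ q ∈ l, q ∈ P}).Infinite ↔
      ∃ (ξ : ℕ → A) (p : ℕ → Q) (η : ℕ → ℕ → A),
        (∀ i, p i ∈ P) ∧ η 0 = ξ ∧
        (∀ i n : ℕ,
          seqAct δ ((List.ofFn fun k : Fin i => p k).reverse) (pre ξ n) =
            some (pre (η i) n)) ∧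
        Function.Injective η := by
  constructor
  · intro hinf
    have hunb : ¬ BoundedPotential δ P [] := fun hb => by
      refine hinf ((finite_range_subAct hb).subset ?_)
      rintro _ ⟨l, ⟨-, hl⟩, rfl⟩
      lift l to List P using hl
      exact ⟨l, rfl⟩
    obtain ⟨ξ, hξ⟩ := exists_forall_not_orbitRadiusLT_pre hunb
    obtain ⟨p, η, hη, hinj⟩ := exists_infinite_orbital_path hξ
    refine ⟨ξ, fun n => p n, η, fun n => (p n).2, ?_, fun i n => ?_, hinj⟩
    · exact eq_of_forall_pre_eq fun n => (Option.some.inj (hη 0 n)).symm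
    · simpa [subAct, List.map_ofFn, Function.comp_def] using hη i n
  · rintro ⟨ξ, p, η, hp, -, hη, hinj⟩
    refine Set.infinite_of_injective_forall_mem
      (f := fun i => seqAct δ (List.ofFn fun k : Fin (i + 1) => p k).reverse)
      (fun i j hij => ?_) fun i => ⟨_, ⟨by simp, ?_⟩, rfl⟩
    · refine Nat.succ_injective (hinj (eq_of_forall_pre_eq fun n => Option.some.inj ?_))
      exact (hη _ n).symm.trans ((congrFun hij (pre ξ n)).trans (hη _ n))
    · simp only [List.mem_reverse, List.mem_ofFn]
      rintro _ ⟨k, rfl⟩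
      exact hp k

end AutOrbit
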